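/- arXiv:1807.03896 — 3 statements merged into one kernel-verified Lean document; each statement's English description precedes it below -/
import Mathlib

section
/- Let 𝔤 = 2𝒜₂ be the 4-dimensional real Lie algebra with brackets [e₁,e₂] = e₂ and [e₃,e₄] = e₄, and let a₅ > 0. The trace-free Ricci tensor of the inner product g = e¹⊗e¹ + e²⊗e² + a₅ e³⊗e³ + e⁴⊗e⁴ is Ric₀ = ((1−a₅)/(2a₅)) e¹⊗e¹ + ((1−a₅)/(2a₅)) e²⊗e² + ((a₅−1)/2) e³⊗e³ + ((a₅−1)/(2a₅)) e⁴⊗e⁴. In particular, g is Einstein if and only if a₅ = 1. -/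
open scoped BigOperators

noncomputable section

/-- The underlying vector space `ℝ⁴` of the 4-dimensional Lie algebra. -/
abbrev V4 : Type := Fin 4 → ℝ

/-- The standard basis `e₁, e₂, e₃, e₄` (0-indexed). -/
def ee (i : Fin 4) : V4 := Pi.single i 1

/-- `g` is an inner product: a positive-definite symmetric bilinear form. -/
structure IsInnerProduct (g : V4 → V4 → ℝ) : Prop where
  symm : ∀ x y, g x y = g y x
  add_left : ∀ x y z, g (x + y) z = g x z + g y z
  smul_left : ∀ (a : ℝ) (x y : V4), g (a • x) y = a * g x y
  pos : ∀ x : V4, x ≠ 0 → 0 < g x x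

/-- `F` is an alternating bilinear 2-form. -/
structure IsAltForm (F : V4 → V4 → ℝ) : Prop where
  skew : ∀ x y, F x y = - F y x
  add_left : ∀ x y z, F (x + y) z = F x z + F y z
  smul_left : ∀ (a : ℝ) (x y : V4), F (a • x) y = a * F x y

/-- Chevalley–Eilenberg differential of a 2-form with respect to the bracket `br`:
`dF(x,y,z) = −F([x,y],z) + F([x,z],y) − F([y,z],x)`. -/
def cdiff (br : V4 → V4 → V4) (F : V4 → V4 → ℝ) (x y z : V4) : ℝ :=
  - F (br x y) z + F (br x z) y - F (br y z) x

/-- A 2-form is closed if its Chevalley–Eilenberg differential vanishes. -/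
def IsClosedForm (br : V4 → V4 → V4) (F : V4 → V4 → ℝ) : Prop :=
  ∀ x y z, cdiff br F x y z = 0

/-- The Gram matrix of a bilinear form in the standard basis. -/
def gram (g : V4 → V4 → ℝ) : Matrix (Fin 4) (Fin 4) ℝ :=
  Matrix.of fun i j => g (ee i) (ee j)

/-- The inverse Gram matrix. -/
def ginv (g : V4 → V4 → ℝ) : Matrix (Fin 4) (Fin 4) ℝ := (gram g)⁻¹

/-- The inner product induced by `g` on 2-forms:
`⟨α,β⟩ = (1/2) Σ g^{ik} g^{jl} α_{ij} β_{kl}`. -/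
def formInner (g : V4 → V4 → ℝ) (α β : V4 → V4 → ℝ) : ℝ :=
  (1 / 2) * ∑ i, ∑ j, ∑ k, ∑ l,
    ginv g i k * ginv g j l * α (ee i) (ee j) * β (ee k) (ee l)

/-- The volume form of `g` for the orientation `e¹∧e²∧e³∧e⁴`. -/
def vol (g : V4 → V4 → ℝ) (x y z w : V4) : ℝ :=
  Real.sqrt (gram g).det * Matrix.det (Matrix.of fun i j => ![x, y, z, w] i j)

/-- The wedge product of two 2-forms, as a 4-form. -/
def wedge22 (α β : V4 → V4 → ℝ) (x y z w : V4) : ℝ :=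
  α x y * β z w - α x z * β y w + α x w * β y z
    + α z w * β x y - α y w * β x z + α y z * β x w

/-- `sF` is the Hodge star `⋆F` of `F` with respect to `g` and the orientation
`e¹∧e²∧e³∧e⁴`: it is the 2-form with `α ∧ sF = ⟨α,F⟩_g vol_g` for all 2-forms `α`. -/
def IsHodgeStar (g : V4 → V4 → ℝ) (F sF : V4 → V4 → ℝ) : Prop :=
  IsAltForm sF ∧
    ∀ α : V4 → V4 → ℝ, IsAltForm α → ∀ x y z w,
      wedge22 α sF x y z w = formInner g α F * vol g x y z w

/-- `F` is co-closed: `d(⋆F) = 0`. -/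
def IsCoclosed (br : V4 → V4 → V4) (g F : V4 → V4 → ℝ) : Prop :=
  ∃ sF, IsHodgeStar g F sF ∧ IsClosedForm br sF

/-- Koszul expression: `g(∇ₓy, z) = (1/2)(g([x,y],z) − g([y,z],x) + g([z,x],y))`. -/
def koszul (br : V4 → V4 → V4) (g : V4 → V4 → ℝ) (x y z : V4) : ℝ :=
  (1 / 2) * (g (br x y) z - g (br y z) x + g (br z x) y)

/-- The Levi-Civita product `∇ₓ y`, i.e. the unique vector with
`g(∇ₓy, z) = koszul x y z` for all `z` (computed via the inverse Gram matrix). -/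
def LC (br : V4 → V4 → V4) (g : V4 → V4 → ℝ) (x y : V4) : V4 :=
  fun m => ∑ k, koszul br g x y (ee k) * ginv g k m

/-- Curvature `R(x,y)z = ∇ₓ∇_y z − ∇_y∇ₓ z − ∇_{[x,y]} z`. -/
def curv (br : V4 → V4 → V4) (g : V4 → V4 → ℝ) (x y z : V4) : V4 :=
  LC br g x (LC br g y z) - LC br g y (LC br g x z) - LC br g (br x y) z

/-- Ricci tensor `Ric(x,y) = Σᵢ g(R(vᵢ,x)y, vᵢ)` for a `g`-orthonormal basis `(vᵢ)`,
i.e. the trace of the endomorphism `z ↦ R(z,x)y`. -/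
def ricci (br : V4 → V4 → V4) (g : V4 → V4 → ℝ) (x y : V4) : ℝ :=
  ∑ i, curv br g (ee i) x y i

/-- Scalar curvature: the `g`-trace of the Ricci tensor. -/
def scal (br : V4 → V4 → V4) (g : V4 → V4 → ℝ) : ℝ :=
  ∑ a, ∑ b, ginv g a b * ricci br g (ee a) (ee b)

/-- Trace-free Ricci tensor `Ric₀ = Ric − (s/4) g`. -/
def ricci0 (br : V4 → V4 → V4) (g : V4 → V4 → ℝ) (x y : V4) : ℝ :=
  ricci br g x y - (scal br g / 4) * g x y

/-- `g` is Einstein: `Ric₀ = 0`. -/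
def IsEinstein (br : V4 → V4 → V4) (g : V4 → V4 → ℝ) : Prop :=
  ∀ x y, ricci0 br g x y = 0

/-- The endomorphism `F̂` with `g(F̂x, y) = F(x,y)` (computed via the inverse Gram matrix). -/
def fhat (g F : V4 → V4 → ℝ) (x : V4) : V4 :=
  fun m => ∑ k, F x (ee k) * ginv g k m

/-- `[F∘F]₀(x,y) = g(F̂(F̂x), y) − (1/4) tr(F̂∘F̂) g(x,y)`. -/
def FF0 (g F : V4 → V4 → ℝ) (x y : V4) : ℝ :=
  g (fhat g F (fhat g F x)) y
    - (1 / 4) * (∑ i, fhat g F (fhat g F (ee i)) i) * g x y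

/-- `(g, F)` is a solution of the Einstein--Maxwell equations:
`dF = 0`, `d(⋆F) = 0`, and `Ric₀ = −[F∘F]₀`. -/
def IsEMSolution (br : V4 → V4 → V4) (g F : V4 → V4 → ℝ) : Prop :=
  IsClosedForm br F ∧ IsCoclosed br g F ∧ ∀ x y, ricci0 br g x y = - FF0 g F x y

/-- Nijenhuis tensor `N_J(x,y) = [Jx,Jy] − J[Jx,y] − J[x,Jy] − [x,y]`. -/
def nijenhuis (br : V4 → V4 → V4) (J : V4 →ₗ[ℝ] V4) (x y : V4) : V4 :=
  br (J x) (J y) - J (br (J x) y) - J (br x (J y)) - br x y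

/-- The Lie algebra `2𝒜₂`: `[e₁,e₂] = e₂`, `[e₃,e₄] = e₄`. -/
def br2A2 : V4 → V4 → V4 := fun x y =>
  (x 0 * y 1 - x 1 * y 0) • ee 1 + (x 2 * y 3 - x 3 * y 2) • ee 3

/-- The diagonal metric `e¹⊗e¹ + e²⊗e² + a e³⊗e³ + e⁴⊗e⁴`. -/
def diagMetric (a : ℝ) : V4 → V4 → ℝ :=
  fun x y => x 0 * y 0 + x 1 * y 1 + a * (x 2 * y 2) + x 3 * y 3

lemma ginv_diagMetric {a : ℝ} (ha : a ≠ 0) :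
    ginv (diagMetric a) = Matrix.diagonal ![1, 1, a⁻¹, 1] := by
  have hgram : gram (diagMetric a) = Matrix.diagonal ![1, 1, a, 1] := by
    ext i j
    fin_cases i <;> fin_cases j <;> simp [gram, diagMetric, ee, Matrix.diagonal]
  rw [ginv, hgram]
  refine Matrix.inv_eq_right_inv ?_
  rw [Matrix.diagonal_mul_diagonal, ← Matrix.diagonal_one]
  congr 1
  ext i
  fin_cases i <;> simp [ha]

lemma LC_br2A2_diagMetric {a : ℝ} (ha : a ≠ 0) (x y : V4) :
    LC br2A2 (diagMetric a) x y = ![x 1 * y 1, -(x 1 * y 0), x 3 * y 3 / a, -(x 3 * y 2)] := by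
  ext m
  simp only [LC, ginv_diagMetric ha, Fin.sum_univ_four]
  fin_cases m <;> simp [koszul, br2A2, diagMetric, ee, Matrix.diagonal] <;> field_simp <;> ring

lemma ricci_br2A2_diagMetric {a : ℝ} (ha : a ≠ 0) (x y : V4) :
    ricci br2A2 (diagMetric a) x y =
      -(x 0 * y 0) - x 1 * y 1 - x 2 * y 2 - x 3 * y 3 / a := by
  simp only [ricci, curv, LC_br2A2_diagMetric ha, Fin.sum_univ_four]
  simp [br2A2, ee]
  ring

lemma scal_br2A2_diagMetric {a : ℝ} (ha : a ≠ 0) :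
    scal br2A2 (diagMetric a) = -2 - 2 / a := by
  simp only [scal, ginv_diagMetric ha, ricci_br2A2_diagMetric ha, Fin.sum_univ_four]
  simp [ee, Matrix.diagonal]
  ring

/-- the trace-free Ricci tensor of
`g = e¹⊗e¹ + e²⊗e² + a₅ e³⊗e³ + e⁴⊗e⁴` on `2𝒜₂`, and the Einstein condition. -/
theorem stmt1 (a5 : ℝ) (ha5 : 0 < a5)
    (g : V4 → V4 → ℝ)
    (hg : g = fun x y => x 0 * y 0 + x 1 * y 1 + a5 * (x 2 * y 2) + x 3 * y 3) :
    (∀ x y : V4, ricci0 br2A2 g x y =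
      ((1 - a5) / (2 * a5)) * (x 0 * y 0) + ((1 - a5) / (2 * a5)) * (x 1 * y 1)
        + ((a5 - 1) / 2) * (x 2 * y 2) + ((a5 - 1) / (2 * a5)) * (x 3 * y 3)) ∧
    (IsEinstein br2A2 g ↔ a5 = 1) := by
  have ha : a5 ≠ 0 := ha5.ne'
  obtain rfl : g = diagMetric a5 := hg
  have hric : ∀ x y : V4, ricci0 br2A2 (diagMetric a5) x y =
      ((1 - a5) / (2 * a5)) * (x 0 * y 0) + ((1 - a5) / (2 * a5)) * (x 1 * y 1)
        + ((a5 - 1) / 2) * (x 2 * y 2) + ((a5 - 1) / (2 * a5)) * (x 3 * y 3) := by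
    intro x y
    rw [ricci0, ricci_br2A2_diagMetric ha, scal_br2A2_diagMetric ha, diagMetric]
    field_simp
    ring
  refine ⟨hric, fun h => ?_, fun h x y => ?_⟩
  · have h2 := h (ee 2) (ee 2)
    rw [hric] at h2
    simp [ee] at h2
    linarith
  · rw [hric, h]
    ring
end
end

section
/- Let a ∈ ℝ with a ≠ 0 and let 𝔤 = 𝒜₄,₆^{a,0} be the 4-dimensional real Lie algebra with brackets [e₁,e₄] = a e₁, [e₂,e₄] = −e₃, [e₃,e₄] = e₂. Let a₁₄, a₂₃ ∈ ℝ satisfy a₂₃² − a₁₄² = a². Then the Euclidean inner product g = e¹⊗e¹ + e²⊗e² + e³⊗e³ + e⁴⊗e⁴ together with the 2-form F = a₁₄ e¹∧e⁴ + a₂₃ e²∧e³ is a solution of the Einstein–Maxwell equations, and g is not Einstein. -/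
open scoped BigOperators

noncomputable section

/-- The Lie algebra `𝒜₄,₆^{a,0}`: `[e₁,e₄] = a e₁`, `[e₂,e₄] = −e₃`, `[e₃,e₄] = e₂`. -/
def brA46a0 (a : ℝ) : V4 → V4 → V4 := fun x y =>
  (a * (x 0 * y 3 - x 3 * y 0)) • ee 0
    + (x 2 * y 3 - x 3 * y 2) • ee 1
    + (-(x 1 * y 3 - x 3 * y 1)) • ee 2

/-- The Euclidean inner product on `V4`. -/
def euclid : V4 → V4 → ℝ := fun x y => x 0 * y 0 + x 1 * y 1 + x 2 * y 2 + x 3 * y 3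

/-- The 2-form `p e¹∧e⁴ + q e²∧e³`. -/
def form1423 (p q : ℝ) : V4 → V4 → ℝ :=
  fun x y => p * (x 0 * y 3 - x 3 * y 0) + q * (x 1 * y 2 - x 2 * y 1)

lemma isInnerProduct_euclid : IsInnerProduct euclid where
  symm x y := by simp only [euclid]; ring
  add_left x y z := by simp only [euclid, Pi.add_apply]; ring
  smul_left a x y := by simp only [euclid, Pi.smul_apply, smul_eq_mul]; ring
  pos x hx := by
    obtain ⟨i, hi⟩ := Function.ne_iff.mp hx
    have hle := Finset.single_le_sum (f := fun j => x j * x j)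
      (fun j _ => mul_self_nonneg (x j)) (Finset.mem_univ i)
    rw [Fin.sum_univ_four] at hle
    exact (mul_self_pos.mpr hi).trans_le hle

lemma isAltForm_form1423 (p q : ℝ) : IsAltForm (form1423 p q) where
  skew x y := by simp only [form1423]; ring
  add_left x y z := by simp only [form1423, Pi.add_apply]; ring
  smul_left a x y := by simp only [form1423, Pi.smul_apply, smul_eq_mul]; ring

lemma gram_euclid : gram euclid = 1 := by
  ext i j
  fin_cases i <;> fin_cases j <;> simp [gram, euclid, ee]

lemma ginv_euclid : ginv euclid = 1 := by
  simp [ginv, gram_euclid]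

lemma eq_sum_smul_ee (x : V4) :
    x = x 0 • ee 0 + (x 1 • ee 1 + (x 2 • ee 2 + x 3 • ee 3)) := by
  ext i
  fin_cases i <;> simp [ee]

lemma IsAltForm.apply_eq_sum {α : V4 → V4 → ℝ} (hα : IsAltForm α) (x y : V4) :
    α x y = (x 0 * y 1 - x 1 * y 0) * α (ee 0) (ee 1)
      + (x 0 * y 2 - x 2 * y 0) * α (ee 0) (ee 2)
      + (x 0 * y 3 - x 3 * y 0) * α (ee 0) (ee 3)
      + (x 1 * y 2 - x 2 * y 1) * α (ee 1) (ee 2)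
      + (x 1 * y 3 - x 3 * y 1) * α (ee 1) (ee 3)
      + (x 2 * y 3 - x 3 * y 2) * α (ee 2) (ee 3) := by
  have expand (u v : V4) : α u v = u 0 * α (ee 0) v
      + (u 1 * α (ee 1) v + (u 2 * α (ee 2) v + u 3 * α (ee 3) v)) := by
    conv_lhs => rw [eq_sum_smul_ee u]
    simp only [hα.add_left, hα.smul_left]
  have self (i : Fin 4) : α (ee i) (ee i) = 0 := by linarith [hα.skew (ee i) (ee i)]
  have expand_ee (i : Fin 4) : α (ee i) y = y 0 * α (ee i) (ee 0)
      + (y 1 * α (ee i) (ee 1) + (y 2 * α (ee i) (ee 2) + y 3 * α (ee i) (ee 3))) := by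
    rw [hα.skew, expand y, hα.skew (ee i) (ee 0), hα.skew (ee i) (ee 1),
      hα.skew (ee i) (ee 2), hα.skew (ee i) (ee 3)]
    ring
  rw [expand x y]
  simp only [expand_ee, self]
  rw [hα.skew (ee 1) (ee 0), hα.skew (ee 2) (ee 0), hα.skew (ee 3) (ee 0),
    hα.skew (ee 2) (ee 1), hα.skew (ee 3) (ee 1), hα.skew (ee 3) (ee 2)]
  ring

lemma formInner_euclid_form1423 {α : V4 → V4 → ℝ} (hα : IsAltForm α) (p q : ℝ) :
    formInner euclid α (form1423 p q) = p * α (ee 0) (ee 3) + q * α (ee 1) (ee 2) := by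
  have h30 := hα.skew (ee 3) (ee 0)
  have h21 := hα.skew (ee 2) (ee 1)
  simp [formInner, ginv_euclid, Matrix.one_apply, form1423, Fin.sum_univ_four, ee] at *
  rw [h30, h21]
  ring

lemma vol_euclid (x y z w : V4) :
    vol euclid x y z w = (Matrix.of fun i j => ![x, y, z, w] i j).det := by
  simp [vol, gram_euclid]

lemma isHodgeStar_form1423 (p q : ℝ) :
    IsHodgeStar euclid (form1423 p q) (form1423 q p) := by
  refine ⟨isAltForm_form1423 q p, fun α hα x y z w => ?_⟩
  rw [formInner_euclid_form1423 hα, vol_euclid, wedge22, hα.apply_eq_sum x y,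
    hα.apply_eq_sum x z, hα.apply_eq_sum x w, hα.apply_eq_sum z w, hα.apply_eq_sum y w,
    hα.apply_eq_sum y z]
  simp [Matrix.det_succ_row_zero, Fin.sum_univ_succ, Fin.succAbove, form1423]
  ring

lemma isClosedForm_form1423 (a p q : ℝ) :
    IsClosedForm (brA46a0 a) (form1423 p q) := by
  intro x y z
  simp [cdiff, form1423, brA46a0, ee]
  ring

lemma LC_brA46a0 (a : ℝ) (x y : V4) :
    LC (brA46a0 a) euclid x y =
      ![a * x 0 * y 3, -(x 3 * y 2), x 3 * y 1, -(a * x 0 * y 0)] := by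
  ext i
  fin_cases i <;>
    simp [LC, koszul, ginv_euclid, Matrix.one_apply, euclid, brA46a0, ee] <;>
    ring

lemma ricci_brA46a0 (a : ℝ) (x y : V4) :
    ricci (brA46a0 a) euclid x y = -a ^ 2 * (x 0 * y 0 + x 3 * y 3) := by
  simp [ricci, curv, LC_brA46a0, Fin.sum_univ_four, brA46a0, ee]
  ring

lemma scal_brA46a0 (a : ℝ) : scal (brA46a0 a) euclid = -2 * a ^ 2 := by
  simp [scal, ginv_euclid, Matrix.one_apply, ricci_brA46a0, Fin.sum_univ_four, ee]
  ring

lemma ricci0_brA46a0 (a : ℝ) (x y : V4) :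
    ricci0 (brA46a0 a) euclid x y =
      a ^ 2 / 2 * (x 1 * y 1 + x 2 * y 2 - x 0 * y 0 - x 3 * y 3) := by
  rw [ricci0, ricci_brA46a0, scal_brA46a0, euclid]
  ring

lemma fhat_form1423 (p q : ℝ) (x : V4) :
    fhat euclid (form1423 p q) x = ![-(p * x 3), -(q * x 2), q * x 1, p * x 0] := by
  ext i
  fin_cases i <;>
    simp [fhat, ginv_euclid, Matrix.one_apply, form1423, ee]

lemma FF0_form1423 (p q : ℝ) (x y : V4) :
    FF0 euclid (form1423 p q) x y =
      (q ^ 2 - p ^ 2) / 2 * (x 0 * y 0 + x 3 * y 3 - x 1 * y 1 - x 2 * y 2) := by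
  simp [FF0, fhat_form1423, Fin.sum_univ_four, euclid, ee]
  ring

/-- on `𝒜₄,₆^{a,0}` with `a ≠ 0`, if `a₂₃² − a₁₄² = a²` then the Euclidean metric
with `F = a₁₄ e¹∧e⁴ + a₂₃ e²∧e³` is a non-Einstein solution of the Einstein--Maxwell equations. -/
theorem stmt3 (a : ℝ) (ha : a ≠ 0) (a14 a23 : ℝ) (h : a23 ^ 2 - a14 ^ 2 = a ^ 2)
    (g F : V4 → V4 → ℝ)
    (hg : g = fun x y => x 0 * y 0 + x 1 * y 1 + x 2 * y 2 + x 3 * y 3)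
    (hF : F = fun x y => a14 * (x 0 * y 3 - x 3 * y 0) + a23 * (x 1 * y 2 - x 2 * y 1)) :
    IsInnerProduct g ∧ IsAltForm F ∧ IsEMSolution (brA46a0 a) g F ∧ ¬ IsEinstein (brA46a0 a) g := by
  change g = euclid at hg
  change F = form1423 a14 a23 at hF
  subst hg hF
  refine ⟨isInnerProduct_euclid, isAltForm_form1423 _ _, ⟨isClosedForm_form1423 _ _ _,
    ⟨_, isHodgeStar_form1423 _ _, isClosedForm_form1423 _ _ _⟩, fun x y => ?_⟩, fun hE => ?_⟩
  · rw [ricci0_brA46a0, FF0_form1423, h]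
    ring
  · have h11 := hE (ee 1) (ee 1)
    rw [ricci0_brA46a0] at h11
    simp [ee, ha] at h11
end
end

section
/- Let p ∈ ℝ with p ≠ 0 and let 𝔤 = 𝒜₄,₂^p be the 4-dimensional real Lie algebra with brackets [e₁,e₄] = p e₁, [e₂,e₄] = e₂, [e₃,e₄] = e₂ + e₃. Then for every inner product g on 𝔤 and every alternating 2-form F on 𝔤 such that (g,F) is a solution of the Einstein–Maxwell equations, the metric g is Einstein. -/
open scoped BigOperators

noncomputable section

/-- The Lie algebra `𝒜₄,₂^p`: `[e₁,e₄] = p e₁`, `[e₂,e₄] = e₂`, `[e₃,e₄] = e₂ + e₃`. -/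
def brA42 (p : ℝ) : V4 → V4 → V4 := fun x y =>
  (p * (x 0 * y 3 - x 3 * y 0)) • ee 0
    + ((x 1 * y 3 - x 3 * y 1) + (x 2 * y 3 - x 3 * y 2)) • ee 1
    + (x 2 * y 3 - x 3 * y 2) • ee 2

/-- A family is a `g`-orthonormal frame. -/
def IsFrame (g : V4 → V4 → ℝ) (w : Fin 4 → V4) : Prop :=
  ∀ i j, g (w i) (w j) = if i = j then 1 else 0

lemma IsLinearMap.apply_sum_smul {M : Type*} [AddCommGroup M] [Module ℝ M] {f : V4 → M}
    (hf : IsLinearMap ℝ f) (c : Fin 4 → ℝ) (v : Fin 4 → V4) :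
    f (∑ i, c i • v i) = ∑ i, c i • f (v i) := by
  change hf.mk' f _ = _
  rw [map_sum]
  exact Finset.sum_congr rfl fun i _ => hf.map_smul _ _

lemma sum_smul_ee (x : V4) : ∑ k, x k • ee k = x := by
  ext m
  simp [ee, Finset.sum_apply, Pi.single_apply]

lemma IsLinearMap.apply_eq_sum_ee {M : Type*} [AddCommGroup M] [Module ℝ M] {f : V4 → M}
    (hf : IsLinearMap ℝ f) (x : V4) : f x = ∑ k, x k • f (ee k) := by
  rw [← hf.apply_sum_smul, sum_smul_ee]

lemma IsInnerProduct.linear_left {g : V4 → V4 → ℝ} (hg : IsInnerProduct g) (y : V4) :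
    IsLinearMap ℝ (fun x => g x y) :=
  ⟨fun _ _ => hg.add_left _ _ _, fun _ _ => hg.smul_left _ _ _⟩

lemma IsInnerProduct.linear_right {g : V4 → V4 → ℝ} (hg : IsInnerProduct g) (x : V4) :
    IsLinearMap ℝ (fun y => g x y) := by
  simp only [hg.symm x]
  exact hg.linear_left x

lemma IsAltForm.linear_left {F : V4 → V4 → ℝ} (hF : IsAltForm F) (y : V4) :
    IsLinearMap ℝ (fun x => F x y) :=
  ⟨fun _ _ => hF.add_left _ _ _, fun _ _ => hF.smul_left _ _ _⟩

lemma IsAltForm.linear_right {F : V4 → V4 → ℝ} (hF : IsAltForm F) (x : V4) :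
    IsLinearMap ℝ (fun y => F x y) := by
  refine ⟨fun y z => ?_, fun a y => ?_⟩
  · rw [hF.skew, hF.add_left, hF.skew x y, hF.skew x z]; ring
  · rw [hF.skew, hF.smul_left, hF.skew x y, smul_eq_mul]; ring

lemma IsAltForm.self {F : V4 → V4 → ℝ} (hF : IsAltForm F) (x : V4) : F x x = 0 := by
  linarith [hF.skew x x]

lemma brA42_linear_left (p : ℝ) (y : V4) : IsLinearMap ℝ (fun x => brA42 p x y) := by
  refine ⟨fun u v => ?_, fun a u => ?_⟩ <;> ext m <;> simp [brA42] <;> ring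

lemma brA42_skew (p : ℝ) (x y : V4) : brA42 p x y = - brA42 p y x := by
  ext m; simp [brA42]; ring

lemma brA42_linear_right (p : ℝ) (x : V4) : IsLinearMap ℝ (fun y => brA42 p x y) := by
  refine ⟨fun u v => ?_, fun a u => ?_⟩ <;> ext m <;> simp [brA42] <;> ring

section Koszul

variable {g : V4 → V4 → ℝ} (hg : IsInnerProduct g) (p : ℝ)
include hg

lemma koszul_linear_left (y z : V4) : IsLinearMap ℝ (fun x => koszul (brA42 p) g x y z) := by
  refine ⟨fun u v => ?_, fun a u => ?_⟩
  · simp only [koszul, (brA42_linear_left p _).map_add, (brA42_linear_right p _).map_add,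
      (hg.linear_left _).map_add, (hg.linear_right _).map_add]
    ring
  · simp only [koszul, (brA42_linear_left p _).map_smul, (brA42_linear_right p _).map_smul,
      (hg.linear_left _).map_smul, (hg.linear_right _).map_smul, smul_eq_mul]
    ring

lemma koszul_linear_mid (x z : V4) : IsLinearMap ℝ (fun y => koszul (brA42 p) g x y z) := by
  refine ⟨fun u v => ?_, fun a u => ?_⟩
  · simp only [koszul, (brA42_linear_left p _).map_add, (brA42_linear_right p _).map_add,
      (hg.linear_left _).map_add, (hg.linear_right _).map_add]
    ring
  · simp only [koszul, (brA42_linear_left p _).map_smul, (brA42_linear_right p _).map_smul,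
      (hg.linear_left _).map_smul, (hg.linear_right _).map_smul, smul_eq_mul]
    ring

lemma koszul_linear_right (x y : V4) : IsLinearMap ℝ (fun z => koszul (brA42 p) g x y z) := by
  refine ⟨fun u v => ?_, fun a u => ?_⟩
  · simp only [koszul, (brA42_linear_left p _).map_add, (brA42_linear_right p _).map_add,
      (hg.linear_left _).map_add, (hg.linear_right _).map_add]
    ring
  · simp only [koszul, (brA42_linear_left p _).map_smul, (brA42_linear_right p _).map_smul,
      (hg.linear_left _).map_smul, (hg.linear_right _).map_smul, smul_eq_mul]
    ring

lemma LC_linear_left (y : V4) : IsLinearMap ℝ (fun x => LC (brA42 p) g x y) := by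
  refine ⟨fun u v => ?_, fun a u => ?_⟩ <;> ext m
  · simp only [LC, (koszul_linear_left hg p _ _).map_add, Pi.add_apply, add_mul,
      Finset.sum_add_distrib]
  · simp only [LC, (koszul_linear_left hg p _ _).map_smul, Pi.smul_apply, smul_eq_mul,
      Finset.mul_sum, mul_assoc]

lemma LC_linear_right (x : V4) : IsLinearMap ℝ (fun y => LC (brA42 p) g x y) := by
  refine ⟨fun u v => ?_, fun a u => ?_⟩ <;> ext m
  · simp only [LC, (koszul_linear_mid hg p _ _).map_add, Pi.add_apply, add_mul,
      Finset.sum_add_distrib]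
  · simp only [LC, (koszul_linear_mid hg p _ _).map_smul, Pi.smul_apply, smul_eq_mul,
      Finset.mul_sum, mul_assoc]

lemma curv_linear_left (x y : V4) : IsLinearMap ℝ (fun z => curv (brA42 p) g z x y) := by
  refine ⟨fun u v => ?_, fun a u => ?_⟩
  · simp only [curv, (LC_linear_left hg p _).map_add, (LC_linear_right hg p _).map_add,
      (brA42_linear_left p _).map_add]
    abel
  · simp only [curv, (LC_linear_left hg p _).map_smul, (LC_linear_right hg p _).map_smul,
      (brA42_linear_left p _).map_smul, smul_sub]

end Koszul

section Frame

variable {g : V4 → V4 → ℝ} (hg : IsInnerProduct g) {w : Fin 4 → V4} (hw : IsFrame g w)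
include hg hw

lemma IsFrame.mul_gram_mul : Matrix.of w * (gram g * (Matrix.of w).transpose) = 1 := by
  ext i j
  have h := hw i j
  rw [(hg.linear_left (w j)).apply_eq_sum_ee] at h
  simp only [fun k => (hg.linear_right (ee k)).apply_eq_sum_ee (w j)] at h
  rw [Matrix.one_apply, ← h]
  simp only [Matrix.mul_apply, Matrix.of_apply, gram, Matrix.transpose_apply, smul_eq_mul]
  exact Finset.sum_congr rfl fun k _ => by
    congr 1
    exact Finset.sum_congr rfl fun l _ => mul_comm _ _

lemma IsFrame.gram_mul : gram g * ((Matrix.of w).transpose * Matrix.of w) = 1 := by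
  rw [← Matrix.mul_assoc]
  exact mul_eq_one_comm.mp (hw.mul_gram_mul hg)

lemma IsFrame.ginv_apply (k m : Fin 4) : ginv g k m = ∑ i, w i k * w i m := by
  rw [ginv, Matrix.inv_eq_right_inv (hw.gram_mul hg)]
  simp [Matrix.mul_apply]

lemma IsFrame.vol_ne_zero : vol g (w 0) (w 1) (w 2) (w 3) ≠ 0 := by
  have h := congrArg Matrix.det (hw.mul_gram_mul hg)
  rw [Matrix.det_mul, Matrix.det_mul, Matrix.det_transpose, Matrix.det_one] at h
  have h1 : (Matrix.of w).det ≠ 0 := fun h0 => by simp [h0] at h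
  have h2 : 0 < (gram g).det := by
    by_contra! hn
    nlinarith [mul_nonneg (sq_nonneg (Matrix.of w).det) (neg_nonneg.mpr hn)]
  have h3 : (Matrix.of fun i j => ![w 0, w 1, w 2, w 3] i j) = Matrix.of w := by
    ext i j; fin_cases i <;> rfl
  rw [vol, h3]
  exact mul_ne_zero (Real.sqrt_pos.mpr h2).ne' h1

lemma IsFrame.expand (x : V4) : x = ∑ i, g x (w i) • w i := by
  ext m
  have key : ∀ k, (∑ i, g (ee k) (w i) * w i m) = if k = m then 1 else 0 := by
    intro k
    have h := congrFun (congrFun (hw.gram_mul hg) k) m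
    rw [Matrix.one_apply, ← Matrix.mul_assoc, Matrix.mul_apply] at h
    rw [← h]
    refine Finset.sum_congr rfl fun i _ => ?_
    rw [(hg.linear_right (ee k)).apply_eq_sum_ee (w i)]
    simp only [Matrix.mul_apply, gram, Matrix.of_apply, Matrix.transpose_apply, smul_eq_mul]
    congr 1
    exact Finset.sum_congr rfl fun l _ => mul_comm _ _
  simp only [Finset.sum_apply, Pi.smul_apply, smul_eq_mul,
    fun i => (hg.linear_left (w i)).apply_eq_sum_ee x, Finset.sum_mul]
  rw [Finset.sum_comm]
  simp only [mul_assoc, ← Finset.mul_sum, key]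
  simp

lemma IsFrame.sum_ginv {f : V4 → ℝ} (hf : IsLinearMap ℝ f) :
    (fun m => ∑ k, f (ee k) * ginv g k m) = ∑ i, f (w i) • w i := by
  ext m
  simp only [hw.ginv_apply hg, Finset.mul_sum, Finset.sum_apply, Pi.smul_apply, smul_eq_mul,
    fun i => hf.apply_eq_sum_ee (w i), Finset.sum_mul]
  rw [Finset.sum_comm]
  exact Finset.sum_congr rfl fun i _ => Finset.sum_congr rfl fun k _ => by ring

lemma IsFrame.LC_eq (p : ℝ) (x y : V4) :
    LC (brA42 p) g x y = ∑ i, koszul (brA42 p) g x y (w i) • w i :=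
  hw.sum_ginv hg (koszul_linear_right hg p x y)

lemma IsFrame.fhat_eq {F : V4 → V4 → ℝ} (hF : IsAltForm F) (x : V4) :
    fhat g F x = ∑ i, F x (w i) • w i :=
  hw.sum_ginv hg (hF.linear_right x)

lemma IsFrame.trace_eq {T : V4 → V4} (hT : IsLinearMap ℝ T) :
    ∑ m, T (ee m) m = ∑ i, g (T (w i)) (w i) := by
  have h : ∀ m, T (ee m) m = ∑ i, g (ee m) (w i) * T (w i) m := by
    intro m
    conv_lhs => rw [hw.expand hg (ee m), hT.apply_sum_smul]
    simp [Finset.sum_apply]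
  simp only [h, fun i => (hg.linear_left (w i)).apply_eq_sum_ee (T (w i)), smul_eq_mul]
  rw [Finset.sum_comm]
  exact Finset.sum_congr rfl fun i _ => Finset.sum_congr rfl fun k _ => mul_comm _ _

lemma IsFrame.inner_sum (c : Fin 4 → ℝ) (j : Fin 4) : g (∑ i, c i • w i) (w j) = c j := by
  rw [(hg.linear_left (w j)).apply_sum_smul c w]
  simp only [hw _ j, smul_eq_mul]
  simp

lemma IsFrame.inner_LC (p : ℝ) (x y : V4) (j : Fin 4) :
    g (LC (brA42 p) g x y) (w j) = koszul (brA42 p) g x y (w j) := by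
  rw [hw.LC_eq hg, hw.inner_sum hg]

lemma IsFrame.koszul_LC (p : ℝ) (x y z u : V4) :
    koszul (brA42 p) g x (LC (brA42 p) g y z) u =
      ∑ k, koszul (brA42 p) g y z (w k) * koszul (brA42 p) g x (w k) u := by
  rw [hw.LC_eq hg, (koszul_linear_mid hg p x u).apply_sum_smul]
  rfl

/-- The Ricci tensor in terms of the Christoffel symbols of an orthonormal frame. -/
lemma IsFrame.ricci_eq (p : ℝ) (x y : V4) :
    ricci (brA42 p) g x y =
      ∑ i, ((∑ k, koszul (brA42 p) g x y (w k) * koszul (brA42 p) g (w i) (w k) (w i))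
        - (∑ k, koszul (brA42 p) g (w i) y (w k) * koszul (brA42 p) g x (w k) (w i))
        - koszul (brA42 p) g (brA42 p (w i) x) y (w i)) := by
  rw [ricci, hw.trace_eq hg (curv_linear_left hg p x y)]
  refine Finset.sum_congr rfl fun i _ => ?_
  rw [← hw.koszul_LC hg, ← hw.koszul_LC hg]
  simp only [curv, (hg.linear_left (w i)).map_sub, hw.inner_LC hg]

lemma IsFrame.formInner_wedge {F : V4 → V4 → ℝ} (hF : IsAltForm F) (i j : Fin 4) :
    formInner g (fun x y => g x (w i) * g y (w j) - g x (w j) * g y (w i)) F =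
      F (w i) (w j) := by
  have key : ∀ u (l : Fin 4), (∑ k, ginv g k l * g (ee k) (w u)) = w u l := by
    intro u l
    have h := congrFun (hw.sum_ginv hg (hg.linear_left (w u))) l
    simp only [hw _ u] at h
    simp only [mul_comm (ginv g _ _)]
    rw [h]
    simp [Finset.sum_apply, ite_apply]
  have hexp : ∀ u v, (∑ a, ∑ b, ∑ c, ∑ d,
      ginv g a c * ginv g b d * (g (ee a) (w u) * g (ee b) (w v)) * F (ee c) (ee d))
      = F (w u) (w v) := by
    intro u v
    rw [(hF.linear_left (w v)).apply_eq_sum_ee]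
    simp only [fun k => (hF.linear_right (ee k)).apply_eq_sum_ee (w v), ← key, smul_eq_mul]
    simp only [Fin.sum_univ_four]
    ring
  have hs : formInner g (fun x y => g x (w i) * g y (w j) - g x (w j) * g y (w i)) F =
      1 / 2 * (F (w i) (w j) - F (w j) (w i)) := by
    rw [← hexp i j, ← hexp j i, formInner]
    simp only [← Finset.sum_sub_distrib]
    congr 1
    refine Finset.sum_congr rfl fun a _ => Finset.sum_congr rfl fun b _ =>
      Finset.sum_congr rfl fun c _ => Finset.sum_congr rfl fun d _ => by ring
  rw [hs, hF.skew (w j)]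
  ring

lemma IsFrame.hodge {F sF : V4 → V4 → ℝ} (hF : IsAltForm F) (hs : IsHodgeStar g F sF)
    (i j : Fin 4) :
    wedge22 (fun x y => g x (w i) * g y (w j) - g x (w j) * g y (w i)) sF
      (w 0) (w 1) (w 2) (w 3) = F (w i) (w j) * vol g (w 0) (w 1) (w 2) (w 3) := by
  rw [hs.2, hw.formInner_wedge hg hF]
  refine ⟨fun x y => by ring, fun x y z => ?_, fun a x y => ?_⟩
  · simp only [hg.add_left]; ring
  · simp only [hg.smul_left]; ring

end Frame

/-- An inner product has an orthonormal frame adapted to the flag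
`⟨e₂⟩ ⊂ ⟨e₁, e₂⟩ ⊂ ⟨e₁, e₂, e₃⟩`. -/
lemma IsInnerProduct.exists_frame {g : V4 → V4 → ℝ} (hg : IsInnerProduct g) :
    ∃ w, IsFrame g w ∧
      (w 0 1 ≠ 0 ∧ w 0 0 = 0 ∧ w 0 2 = 0 ∧ w 0 3 = 0) ∧
      (w 1 0 ≠ 0 ∧ w 1 2 = 0 ∧ w 1 3 = 0) ∧
      (w 2 2 ≠ 0 ∧ w 2 3 = 0) ∧ w 3 3 ≠ 0 := by
  have unit : ∀ v : V4, v ≠ 0 → ∃ c : ℝ, c ≠ 0 ∧ g (c • v) (c • v) = 1 := by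
    intro v hv
    have hpos := hg.pos v hv
    refine ⟨(Real.sqrt (g v v))⁻¹, inv_ne_zero (Real.sqrt_pos.mpr hpos).ne', ?_⟩
    rw [(hg.linear_left _).map_smul, (hg.linear_right _).map_smul, smul_eq_mul, smul_eq_mul,
      ← mul_assoc, ← mul_inv, Real.mul_self_sqrt hpos.le, inv_mul_cancel₀ hpos.ne']
  have ne : ∀ (v : V4) (i : Fin 4), v i ≠ 0 → v ≠ 0 := fun v i h h0 => h (by simp [h0])
  obtain ⟨a, ha, ha1⟩ := unit (ee 1) (ne _ 1 (by simp [ee]))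
  generalize hu : a • ee 1 = u at ha1
  have hu0 : u 0 = 0 := by simp [← hu, ee]
  have hu1 : u 1 ≠ 0 := by simpa [← hu, ee]
  have hu2 : u 2 = 0 := by simp [← hu, ee]
  have hu3 : u 3 = 0 := by simp [← hu, ee]
  obtain ⟨b, hb, hb1⟩ := unit (ee 0 - g (ee 0) u • u) (ne _ 0 (by simp [ee, hu0]))
  generalize hv : b • (ee 0 - g (ee 0) u • u) = v at hb1
  have hv0 : v 0 ≠ 0 := by simpa [← hv, ee, hu0]
  have hv2 : v 2 = 0 := by simp [← hv, ee, hu2]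
  have hv3 : v 3 = 0 := by simp [← hv, ee, hu3]
  have hvu : g v u = 0 := by
    rw [← hv]
    simp only [(hg.linear_left _).map_smul, (hg.linear_left _).map_sub, ha1, smul_eq_mul]
    ring
  have huv : g u v = 0 := by rw [hg.symm, hvu]
  obtain ⟨c, hc, hc1⟩ := unit (ee 2 - g (ee 2) u • u - g (ee 2) v • v)
    (ne _ 2 (by simp [ee, hu2, hv2]))
  generalize hx : c • (ee 2 - g (ee 2) u • u - g (ee 2) v • v) = x at hc1
  have hx2 : x 2 ≠ 0 := by simpa [← hx, ee, hu2, hv2]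
  have hx3 : x 3 = 0 := by simp [← hx, ee, hu3, hv3]
  have hxu : g x u = 0 := by
    rw [← hx]
    simp only [(hg.linear_left _).map_smul, (hg.linear_left _).map_sub, ha1, hvu, smul_eq_mul]
    ring
  have hxv : g x v = 0 := by
    rw [← hx]
    simp only [(hg.linear_left _).map_smul, (hg.linear_left _).map_sub, hb1, huv, smul_eq_mul]
    ring
  have hux : g u x = 0 := by rw [hg.symm, hxu]
  have hvx : g v x = 0 := by rw [hg.symm, hxv]
  obtain ⟨d, hd, hd1⟩ := unit (ee 3 - g (ee 3) u • u - g (ee 3) v • v - g (ee 3) x • x)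
    (ne _ 3 (by simp [ee, hu3, hv3, hx3]))
  generalize hy : d • (ee 3 - g (ee 3) u • u - g (ee 3) v • v - g (ee 3) x • x) = y at hd1
  have hy3 : y 3 ≠ 0 := by simpa [← hy, ee, hu3, hv3, hx3]
  have hyu : g y u = 0 := by
    rw [← hy]
    simp only [(hg.linear_left _).map_smul, (hg.linear_left _).map_sub, ha1, hvu, hxu, smul_eq_mul]
    ring
  have hyv : g y v = 0 := by
    rw [← hy]
    simp only [(hg.linear_left _).map_smul, (hg.linear_left _).map_sub, hb1, huv, hxv, smul_eq_mul]
    ring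
  have hyx : g y x = 0 := by
    rw [← hy]
    simp only [(hg.linear_left _).map_smul, (hg.linear_left _).map_sub, hc1, hux, hvx, smul_eq_mul]
    ring
  have huy : g u y = 0 := by rw [hg.symm, hyu]
  have hvy : g v y = 0 := by rw [hg.symm, hyv]
  have hxy : g x y = 0 := by rw [hg.symm, hyx]
  refine ⟨![u, v, x, y], ?_, ⟨hu1, hu0, hu2, hu3⟩, ⟨hv0, hv2, hv3⟩, ⟨hx2, hx3⟩, hy3⟩
  intro i j
  fin_cases i <;> fin_cases j <;> simp [*]

/-- Every inner product has an orthonormal frame in which the last vector acts on the abelian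
ideal spanned by the others by an upper triangular matrix; the final condition says that this
matrix is not diagonalizable. -/
lemma IsInnerProduct.exists_bracket_frame {g : V4 → V4 → ℝ} (hg : IsInnerProduct g) (p : ℝ) :
    ∃ w, IsFrame g w ∧ ∃ t a b c : ℝ, t ≠ 0 ∧ (p ≠ 1 → a * c + (1 - p) * t * b ≠ 0) ∧
      brA42 p (w 0) (w 3) = t • w 0 ∧
      brA42 p (w 1) (w 3) = (t * p) • w 1 + a • w 0 ∧
      brA42 p (w 2) (w 3) = t • w 2 + b • w 0 + c • w 1 ∧
      brA42 p (w 0) (w 1) = 0 ∧ brA42 p (w 0) (w 2) = 0 ∧ brA42 p (w 1) (w 2) = 0 := by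
  obtain ⟨w, hw, ⟨h01, h00, h02, h03⟩, ⟨h10, h12, h13⟩, ⟨h22, h23⟩, h33⟩ := hg.exists_frame
  refine ⟨w, hw, w 3 3, w 3 3 * w 1 1 * (1 - p) / w 0 1,
    (w 3 3 * w 2 2 - w 3 3 * w 2 0 * (p - 1) / w 1 0 * w 1 1) / w 0 1,
    w 3 3 * w 2 0 * (p - 1) / w 1 0, h33, fun hp h => ?_, ?_, ?_, ?_, ?_, ?_, ?_⟩
  · field_simp at h
    have h' : w 3 3 ^ 2 * w 2 2 * (1 - p) * w 1 0 = 0 := by linear_combination h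
    have : 1 - p ≠ 0 := fun h => hp (by linarith)
    simp_all
  all_goals
    ext m
    fin_cases m <;> simp [brA42, ee, h00, h02, h03, h12, h13, h23] <;> field_simp <;> ring

lemma IsFrame.form_eq_zero {g F : V4 → V4 → ℝ} (hg : IsInnerProduct g) {w : Fin 4 → V4}
    (hw : IsFrame g w) (hF : IsAltForm F) (h : ∀ i j, F (w i) (w j) = 0) (x y : V4) :
    F x y = 0 := by
  rw [hw.expand hg x, (hF.linear_left y).apply_sum_smul]
  refine Finset.sum_eq_zero fun i _ => ?_
  rw [hw.expand hg y, (hF.linear_right (w i)).apply_sum_smul]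
  simp [h]

/-- Components along the abelian ideal of a closed 2-form in an adapted frame. -/
lemma closed_components {p t a b c : ℝ} {F : V4 → V4 → ℝ} {w : Fin 4 → V4} (hF : IsAltForm F)
    (hd : IsClosedForm (brA42 p) F) (ht : t ≠ 0) (hn : p ≠ 1 → a * c + (1 - p) * t * b ≠ 0)
    (h0 : brA42 p (w 0) (w 3) = t • w 0)
    (h1 : brA42 p (w 1) (w 3) = (t * p) • w 1 + a • w 0)
    (h2 : brA42 p (w 2) (w 3) = t • w 2 + b • w 0 + c • w 1)
    (h01 : brA42 p (w 0) (w 1) = 0) (h02 : brA42 p (w 0) (w 2) = 0)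
    (h12 : brA42 p (w 1) (w 2) = 0) :
    F (w 0) (w 1) = 0 ∧ F (w 0) (w 2) = 0 ∧ (p ≠ -1 → F (w 1) (w 2) = 0) := by
  have e1 := hd (w 0) (w 1) (w 3)
  have e2 := hd (w 0) (w 2) (w 3)
  have e3 := hd (w 1) (w 2) (w 3)
  simp only [cdiff, h0, h1, h2, h01, h02, h12, (hF.linear_left _).map_zero, hF.add_left,
    hF.smul_left, hF.self, hF.skew (w 1) (w 0), hF.skew (w 2) (w 0), hF.skew (w 2) (w 1)]
    at e1 e2 e3
  have f01 : F (w 0) (w 1) = 0 := by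
    by_cases hp : p = -1
    · have hn' := hn (by rw [hp]; norm_num)
      refine (mul_eq_zero.mp ?_).resolve_left hn'
      subst hp
      linear_combination a * e2 - 2 * t * e3
    · have : t * (1 + p) ≠ 0 := mul_ne_zero ht fun h => hp (by linarith)
      refine (mul_eq_zero.mp ?_).resolve_left this
      linear_combination e1
  have f02 : F (w 0) (w 2) = 0 := by
    refine (mul_eq_zero.mp ?_).resolve_left (mul_ne_zero two_ne_zero ht)
    rw [f01] at e2
    linear_combination e2
  refine ⟨f01, f02, fun hp => ?_⟩
  have : t * (1 + p) ≠ 0 := mul_ne_zero ht fun h => hp (by linarith)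
  refine (mul_eq_zero.mp ?_).resolve_left this
  rw [f01, f02] at e3
  linear_combination e3

/-- The first row of the Ricci tensor in an adapted frame for `p = -1`. -/
lemma ricci_adapted {g : V4 → V4 → ℝ} (hg : IsInnerProduct g) {w : Fin 4 → V4}
    (hw : IsFrame g w) {t a b c : ℝ}
    (h0 : brA42 (-1) (w 0) (w 3) = t • w 0)
    (h1 : brA42 (-1) (w 1) (w 3) = (t * -1) • w 1 + a • w 0)
    (h2 : brA42 (-1) (w 2) (w 3) = t • w 2 + b • w 0 + c • w 1)
    (h01 : brA42 (-1) (w 0) (w 1) = 0) (h02 : brA42 (-1) (w 0) (w 2) = 0)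
    (h12 : brA42 (-1) (w 1) (w 2) = 0) :
    ricci (brA42 (-1)) g (w 0) (w 1) = (b * c - 3 * t * a) / 2 ∧
      ricci (brA42 (-1)) g (w 0) (w 2) = - (t * b) / 2 := by
  have hs (x : V4) : brA42 (-1) x x = 0 := by ext m; simp [brA42]; ring
  have h0' := brA42_skew (-1) (w 3) (w 0)
  have h1' := brA42_skew (-1) (w 3) (w 1)
  have h2' := brA42_skew (-1) (w 3) (w 2)
  have h01' := brA42_skew (-1) (w 1) (w 0)
  have h02' := brA42_skew (-1) (w 2) (w 0)
  have h12' := brA42_skew (-1) (w 2) (w 1)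
  rw [h0] at h0'
  rw [h1] at h1'
  rw [h2] at h2'
  rw [h01] at h01'
  rw [h02] at h02'
  rw [h12] at h12'
  constructor
  all_goals
    rw [hw.ricci_eq hg]
    simp only [Fin.sum_univ_four, h0', h01', h02', hs,
      (koszul_linear_left hg _ _ _).map_smul, (koszul_linear_left hg _ _ _).map_neg, (koszul_linear_left hg _ _ _).map_zero, neg_zero]
    simp only [koszul, h0, h1, h2, h01, h02, h12, h0', h1', h2', h01', h02', h12', hs,
      (hg.linear_left _).map_add, (hg.linear_left _).map_smul, (hg.linear_left _).map_neg,
      (hg.linear_left _).map_zero, hw _ _, neg_zero, smul_eq_mul]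
    norm_num [Fin.ext_iff]
    ring

/-- `𝒜₄,₂^p` (`p ≠ 0`) admits no left-invariant non-Einstein solution to the Einstein--Maxwell equations. -/
theorem stmt8 (p : ℝ) (hp : p ≠ 0) :
    ∀ g F : V4 → V4 → ℝ, IsInnerProduct g → IsAltForm F →
      IsEMSolution (brA42 p) g F → IsEinstein (brA42 p) g := by
  intro g F hg hF ⟨hd, ⟨sF, hs, hds⟩, hE⟩
  obtain ⟨w, hw, t, a, b, c, ht, hn, h0, h1, h2, h01, h02, h12⟩ := hg.exists_bracket_frame p
  obtain ⟨f01, f02, f12⟩ := closed_components hF hd ht hn h0 h1 h2 h01 h02 h12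
  obtain ⟨s01, s02, s12⟩ := closed_components hs.1 hds ht hn h0 h1 h2 h01 h02 h12
  have hvol := hw.vol_ne_zero hg
  have f23 : F (w 2) (w 3) = 0 := by
    have h := hw.hodge hg hF hs 2 3
    simp [wedge22, hw _ _, s01] at h
    simpa [hvol] using h
  have f13 : F (w 1) (w 3) = 0 := by
    have h := hw.hodge hg hF hs 1 3
    simp [wedge22, hw _ _, s02] at h
    simpa [hvol] using h
  have f03 : p ≠ -1 → F (w 0) (w 3) = 0 := by
    intro hp1
    have h := hw.hodge hg hF hs 0 3
    simp [wedge22, hw _ _, s12 hp1] at h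
    simpa [hvol] using h
  by_cases hp1 : p = -1
  · exfalso
    subst hp1
    have hFF : fhat g F (fhat g F (w 0)) = (-F (w 0) (w 3) * F (w 0) (w 3)) • w 0 := by
      have e0 : fhat g F (w 0) = F (w 0) (w 3) • w 3 := by
        rw [hw.fhat_eq hg hF]
        simp [Fin.sum_univ_four, hF.self, f01, f02]
      rw [e0, hw.fhat_eq hg hF]
      simp only [Fin.sum_univ_four, hF.smul_left, hF.self, hF.skew (w 3) (w 0),
        hF.skew (w 3) (w 1), hF.skew (w 3) (w 2), f13, f23]
      simp
    obtain ⟨r1, r2⟩ := ricci_adapted hg hw h0 h1 h2 h01 h02 h12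
    have e1 := hE (w 0) (w 1)
    have e2 := hE (w 0) (w 2)
    rw [ricci0, FF0, hFF, hg.smul_left, hw, r1] at e1
    rw [ricci0, FF0, hFF, hg.smul_left, hw, r2] at e2
    have hb : b = 0 := by simpa [ht] using e2
    have ha : a = 0 := by
      rw [hb] at e1
      simpa [ht] using e1
    exact hn (by norm_num) (by rw [ha, hb]; ring)
  · have hz : ∀ x y, F x y = 0 := by
      refine hw.form_eq_zero hg hF fun i j => ?_
      have f12' := f12 hp1
      have f03' := f03 hp1
      fin_cases i <;> fin_cases j <;>
        first
        | exact hF.self _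
        | assumption
        | (rw [hF.skew, neg_eq_zero]; assumption)
    intro x y
    rw [hE x y]
    have hfz : ∀ z, fhat g F z = 0 := fun z => by ext m; simp [fhat, hz]
    simp [FF0, hfz, (hg.linear_left y).map_zero]
end
end
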